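/- Let n ≥ 2 be an integer, K ≥ 0, A ≥ 0, and t₀ > 0. Then (∫₀^{√(2t₀)} sinh(√(K/(n−1)) r)^{n+4A−1} dr) / (∫₀^{√(t₀)} sinh(√(K/(n−1)) r)^{n+4A−1} dr) ≤ 2^{(n+4A)/2} · e^{(√2 − 1)√(t₀)·√(K/(n−1))·(n+4A−1)}. -/

import Mathlib

/-- The integrand `sinh(√(K/(n−1)) r)^{n+4A−1}` whose integral over `[0, R]`
is (up to a dimensional constant) the volume of the ball of radius `R` in the
`(n+4A)`-dimensional model space of constant curvature `−K/(n−1)`; for `K = 0`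
it is interpreted as the limit `r^{n+4A−1}`. -/
noncomputable def modelIntegrand (n : ℕ) (K A r : ℝ) : ℝ :=
  if K = 0 then r ^ ((n : ℝ) + 4 * A - 1)
  else Real.sinh (Real.sqrt (K / ((n : ℝ) - 1)) * r) ^ ((n : ℝ) + 4 * A - 1)

theorem Real.sinh_mul_le_mul_exp_mul_sinh {a : ℝ} (ha : 1 ≤ a) (x : ℝ) :
    Real.sinh (a * x) ≤ a * Real.exp ((a - 1) * x) * Real.sinh x := by
  have bernoulli : 1 + a * (Real.exp (-2 * x) - 1) ≤ Real.exp (-2 * (a * x)) := by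
    have h := one_add_mul_self_le_rpow_one_add
      (s := Real.exp (-2 * x) - 1) (by linarith [Real.exp_pos (-2 * x)]) ha
    rwa [add_sub_cancel, ← Real.exp_mul, show -2 * x * a = -2 * (a * x) by ring] at h
  have h := mul_le_mul_of_nonneg_left bernoulli (Real.exp_pos (a * x)).le
  have h₁ : Real.exp (a * x) * Real.exp (-2 * (a * x)) = Real.exp (-(a * x)) := by
    rw [← Real.exp_add]; ring_nf
  have h₂ : Real.exp ((a - 1) * x) * Real.exp x = Real.exp (a * x) := by
    rw [← Real.exp_add]; ring_nf
  have h₃ : Real.exp ((a - 1) * x) * Real.exp (-x) =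
      Real.exp (a * x) * Real.exp (-2 * x) := by
    rw [← Real.exp_add, ← Real.exp_add]; ring_nf
  rw [Real.sinh_eq, Real.sinh_eq]
  linear_combination h / 2 + h₁ / 2 - a / 2 * h₂ + a / 2 * h₃

theorem modelIntegrand_nonneg (n : ℕ) (K A : ℝ) {r : ℝ} (hr : 0 ≤ r) :
    0 ≤ modelIntegrand n K A r := by
  unfold modelIntegrand
  split_ifs
  · exact Real.rpow_nonneg hr _
  · exact Real.rpow_nonneg (Real.sinh_nonneg_iff.2 (by positivity)) _

theorem continuous_modelIntegrand {n : ℕ} {A : ℝ} (K : ℝ) (hp : 0 ≤ (n : ℝ) + 4 * A - 1) :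
    Continuous (modelIntegrand n K A) := by
  unfold modelIntegrand
  split_ifs
  · exact continuous_id.rpow_const fun _ => Or.inr hp
  · exact (Real.continuous_sinh.comp (continuous_const.mul continuous_id)).rpow_const
      fun _ => Or.inr hp

theorem modelIntegrand_mul_le {n : ℕ} {K A a r R : ℝ} (hp : 0 ≤ (n : ℝ) + 4 * A - 1)
    (ha : 1 ≤ a) (hr : 0 ≤ r) (hrR : r ≤ R) :
    modelIntegrand n K A (a * r) ≤
      a ^ ((n : ℝ) + 4 * A - 1) *
        Real.exp ((a - 1) * R * Real.sqrt (K / ((n : ℝ) - 1)) * ((n : ℝ) + 4 * A - 1)) *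
        modelIntegrand n K A r := by
  have ha₀ : 0 ≤ a := by linarith
  unfold modelIntegrand
  split_ifs with hK
  · simp [hK, Real.mul_rpow ha₀ hr]
  · set c := Real.sqrt (K / ((n : ℝ) - 1))
    have hc : 0 ≤ c := Real.sqrt_nonneg _
    have hsinh : 0 ≤ Real.sinh (c * r) := Real.sinh_nonneg_iff.2 (by positivity)
    rw [Real.exp_mul, ← Real.mul_rpow ha₀ (Real.exp_pos _).le,
      ← Real.mul_rpow (by positivity) hsinh]
    refine Real.rpow_le_rpow (Real.sinh_nonneg_iff.2 (by positivity)) ?_ hp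
    calc Real.sinh (c * (a * r)) = Real.sinh (a * (c * r)) := by ring_nf
      _ ≤ a * Real.exp ((a - 1) * (c * r)) * Real.sinh (c * r) :=
        Real.sinh_mul_le_mul_exp_mul_sinh ha _
      _ ≤ a * Real.exp ((a - 1) * R * c) * Real.sinh (c * r) := by
        gcongr a * Real.exp ?_ * _
        have := mul_le_mul_of_nonneg_left hrR (mul_nonneg (sub_nonneg.2 ha) hc)
        linarith

/-- **The volume-ratio estimate (2.11) of the paper.**  For an integer
`n ≥ 2`, `K ≥ 0`, `A ≥ 0` and `t₀ > 0`,
`(∫₀^{√(2t₀)} sinh(√(K/(n−1)) r)^{n+4A−1} dr)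
 / (∫₀^{√t₀} sinh(√(K/(n−1)) r)^{n+4A−1} dr)
 ≤ 2^{(n+4A)/2} e^{(√2−1)√t₀·√(K/(n−1))·(n+4A−1)}`. -/
theorem model_volume_ratio_doubling
    (n : ℕ) (hn : 2 ≤ n) (K A t₀ : ℝ)
    (hK : 0 ≤ K) (hA : 0 ≤ A) (ht₀ : 0 < t₀) :
    (∫ r in (0 : ℝ)..Real.sqrt (2 * t₀), modelIntegrand n K A r)
        / (∫ r in (0 : ℝ)..Real.sqrt t₀, modelIntegrand n K A r)
      ≤ (2 : ℝ) ^ (((n : ℝ) + 4 * A) / 2)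
          * Real.exp ((Real.sqrt 2 - 1) * Real.sqrt t₀
              * Real.sqrt (K / ((n : ℝ) - 1)) * ((n : ℝ) + 4 * A - 1)) := by
  have hn' : (2 : ℝ) ≤ n := by exact_mod_cast hn
  have hp : 0 ≤ (n : ℝ) + 4 * A - 1 := by linarith
  have hs : 0 ≤ Real.sqrt t₀ := Real.sqrt_nonneg _
  have ha : 1 ≤ Real.sqrt 2 := Real.one_le_sqrt.2 one_le_two
  have hcont := continuous_modelIntegrand K hp
  refine div_le_of_le_mul₀
    (intervalIntegral.integral_nonneg hs fun r hr => modelIntegrand_nonneg n K A hr.1)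
    (by positivity) ?_
  have hpow : (2 : ℝ) ^ (((n : ℝ) + 4 * A) / 2) =
      Real.sqrt 2 * Real.sqrt 2 ^ ((n : ℝ) + 4 * A - 1) := by
    rw [← Real.rpow_one_add' (by positivity) (by linarith), Real.sqrt_eq_rpow,
      ← Real.rpow_mul zero_le_two]
    ring_nf
  have hsubst : (∫ r in (0 : ℝ)..Real.sqrt (2 * t₀), modelIntegrand n K A r) =
      Real.sqrt 2 * ∫ r in (0 : ℝ)..Real.sqrt t₀, modelIntegrand n K A (Real.sqrt 2 * r) := by
    rw [intervalIntegral.mul_integral_comp_mul_left, mul_zero, Real.sqrt_mul zero_le_two]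
  rw [hsubst, hpow, mul_assoc, mul_assoc, ← mul_assoc (Real.sqrt 2 ^ _)]
  refine mul_le_mul_of_nonneg_left ?_ (Real.sqrt_nonneg _)
  rw [← intervalIntegral.integral_const_mul]
  exact intervalIntegral.integral_mono_on hs
    ((hcont.comp (continuous_const.mul continuous_id)).intervalIntegrable _ _)
    ((continuous_const.mul hcont).intervalIntegrable _ _)
    fun r hr => modelIntegrand_mul_le hp ha hr.1 hr.2
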